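/- If a category K is M-locally generated with respect to some convenient factorization system (E,M) (i.e., K is M-locally λ-generated for some regular cardinal λ), then K is a locally presentable category (locally μ-presentable for some regular cardinal μ, possibly larger than λ). -/

import Mathlib

open CategoryTheory CategoryTheory.Limits Opposite

universe w v u u₂

namespace LocallyGen

variable {K : Type u} [Category.{v} K]

/-- `m` has the unique right lifting property w.r.t. `e`
(every commutative square has a unique diagonal filler). -/
def UniqueLift {A B X Y : K} (e : A ⟶ B) (m : X ⟶ Y) : Prop :=
  ∀ (u : A ⟶ X) (v : B ⟶ Y), u ≫ m = e ≫ v →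
    ∃! d : B ⟶ X, e ≫ d = u ∧ d ≫ m = v

/-- An (orthogonal) factorization system `(E, M)` on `K`: both classes contain all
isomorphisms and are closed under composition, every morphism factors as an `E`-morphism
followed by an `M`-morphism, and `E` is orthogonal to `M`. -/
structure FactorizationSystem (K : Type u) [Category.{v} K] where
  E : MorphismProperty K
  M : MorphismProperty K
  E_iso : ∀ {A B : K} (f : A ⟶ B), IsIso f → E f
  M_iso : ∀ {A B : K} (f : A ⟶ B), IsIso f → M f
  E_comp : ∀ {A B C : K} (f : A ⟶ B) (g : B ⟶ C), E f → E g → E (f ≫ g)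
  M_comp : ∀ {A B C : K} (f : A ⟶ B) (g : B ⟶ C), M f → M g → M (f ≫ g)
  factor : ∀ {A B : K} (f : A ⟶ B), ∃ (C : K) (e : A ⟶ C) (m : C ⟶ B), E e ∧ M m ∧ e ≫ m = f
  orth : ∀ {A B X Y : K} (e : A ⟶ B) (m : X ⟶ Y), E e → M m → UniqueLift e m

/-- A preorder is `κ`-directed if every subset of cardinality `< κ` has an upper bound. -/
def CardinalDirected (I : Type w) [Preorder I] (κ : Cardinal.{w}) : Prop :=
  ∀ S : Set I, Cardinal.mk S < κ → ∃ i : I, ∀ j ∈ S, j ≤ i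

/-- All connecting morphisms of a diagram indexed by a preorder lie in `M`. -/
def DiagramInM (M : MorphismProperty K) {I : Type w} [Preorder I] (D : I ⥤ K) : Prop :=
  ∀ ⦃i j : I⦄ (h : i ≤ j), M (D.map (homOfLE h))

/-- `A` is `κ`-generated w.r.t. `M`: the hom-functor `K(A, -) : K ⥤ Type` preserves
`κ`-directed colimits of `M`-morphisms. -/
def IsGenerated (M : MorphismProperty K) (κ : Cardinal.{v}) (A : K) : Prop :=
  ∀ (I : Type v) [Preorder I], CardinalDirected I κ →
    ∀ (D : I ⥤ K), DiagramInM M D →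
      ∀ (c : Cocone D), IsColimit c →
        Nonempty (IsColimit ((coyoneda.obj (op A)).mapCocone c))

/-- A small category is `κ`-small if it has fewer than `κ` morphisms. -/
def IsCardinalSmall (J : Type w) [SmallCategory J] (κ : Cardinal.{w}) : Prop :=
  Cardinal.mk (Σ (a : J) (b : J), a ⟶ b) < κ

/-- Two `E`-quotients of `A` are isomorphic as quotients. -/
def QuotientRel (E : MorphismProperty K) (A : K)
    (p q : Σ B : K, {e : A ⟶ B // E e}) : Prop :=
  ∃ i : p.1 ≅ q.1, p.2.1 ≫ i.hom = q.2.1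

/-- The factorization system `(E, M)` is `κ`-convenient: `K` is `E`-cowellpowered and
`M` is closed under `κ`-directed colimits. -/
structure Convenient (F : FactorizationSystem K) (κ : Cardinal.{v}) : Prop where
  cowellpowered : ∀ A : K, Small.{v} (Quot (QuotientRel F.E A))
  M_cocone : ∀ (I : Type v) [Preorder I], CardinalDirected I κ →
      ∀ (D : I ⥤ K), DiagramInM F.M D → ∀ (c : Cocone D), IsColimit c →
        ∀ i : I, F.M (c.ι.app i)
  M_desc : ∀ (I : Type v) [Preorder I], CardinalDirected I κ →
      ∀ (D : I ⥤ K), DiagramInM F.M D → ∀ (c : Cocone D) (hc : IsColimit c)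
        (c' : Cocone D), (∀ i : I, F.M (c'.ι.app i)) → F.M (hc.desc c')

/-- A presentation of `X` as a `κ`-directed colimit of objects from `S`
and morphisms from `M`. -/
structure DirectedColimitPresentation (M : MorphismProperty K) (κ : Cardinal.{v})
    (S : Set K) (X : K) where
  I : Type v
  [instI : Preorder I]
  directed : CardinalDirected I κ
  D : I ⥤ K
  mem : ∀ i : I, D.obj i ∈ S
  inM : DiagramInM M D
  c : Cocone D
  pt_eq : c.pt = X
  isColimit : IsColimit c

/-- `K` is `M`-locally `κ`-generated, with witnessing set (of objects) `S`:
`K` is cocomplete, `(E, M)` is `κ`-convenient, `S` is a set of `κ`-generated objects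
w.r.t. `M`, and every object of `K` is a `κ`-directed colimit of objects from `S`
and morphisms from `M`. -/
structure IsLocallyGenerated (F : FactorizationSystem K) (κ : Cardinal.{v})
    (S : Set K) : Prop where
  hasColimits : HasColimits K
  convenient : Convenient F κ
  small : Small.{v} S
  gen : ∀ A ∈ S, IsGenerated F.M κ A
  presentation : ∀ X : K, Nonempty (DirectedColimitPresentation F.M κ S X)

/-- `K` is locally `κ`-presentable: cocomplete with a set `S` of `κ`-presentable objects
such that every object is a `κ`-directed colimit of objects from `S`. -/
def LocallyPresentable (K : Type u) [Category.{v} K] (κ : Cardinal.{v}) : Prop :=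
  HasColimits K ∧ ∃ S : Set K, Small.{v} S ∧
    (∀ A ∈ S, IsGenerated (⊤ : MorphismProperty K) κ A) ∧
    ∀ X : K, Nonempty (DirectedColimitPresentation (⊤ : MorphismProperty K) κ S X)


section Directed

variable {I : Type v} [Preorder I] {κ : Cardinal.{v}}

lemma CardinalDirected.exists_ge (hI : CardinalDirected I κ) {ι : Type*} (s : ι → I)
    (hι : HasCardinalLT ι κ) : ∃ i, ∀ k, s k ≤ i := by
  have h : HasCardinalLT (Set.range s) κ :=
    hι.of_surjective (Set.rangeFactorization s) Set.rangeFactorization_surjective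
  rw [hasCardinalLT_iff_cardinal_mk_lt] at h
  obtain ⟨i, hi⟩ := hI _ h
  exact ⟨i, fun k => hi _ ⟨k, rfl⟩⟩

lemma CardinalDirected.isDirectedOrder (hI : CardinalDirected I κ) (hκ : κ.IsRegular) :
    IsDirectedOrder I where
  directed a b := by
    obtain ⟨i, hi⟩ := hI.exists_ge (fun x : Bool => if x then a else b)
      (hasCardinalLT_of_finite _ _ hκ.aleph0_le)
    exact ⟨i, hi true, hi false⟩

lemma CardinalDirected.nonempty (hI : CardinalDirected I κ) (hκ : κ.IsRegular) :
    Nonempty I := by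
  obtain ⟨i, -⟩ := hI.exists_ge (fun x : PEmpty.{1} => x.elim)
    (hasCardinalLT_of_finite _ _ hκ.aleph0_le)
  exact ⟨i⟩

lemma CardinalDirected.isFiltered (hI : CardinalDirected I κ) (hκ : κ.IsRegular) :
    IsFiltered I := by
  have := hI.isDirectedOrder hκ
  have := hI.nonempty hκ
  infer_instance

lemma CardinalDirected.isCardinalFiltered (hI : CardinalDirected I κ) [Fact κ.IsRegular] :
    IsCardinalFiltered I κ :=
  isCardinalFiltered_preorder _ _ (fun T s hT => hI.exists_ge s
    ((hasCardinalLT_iff_cardinal_mk_lt _ _).2 hT))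

lemma cardinalDirected_of_isCardinalFiltered [Fact κ.IsRegular] [IsCardinalFiltered I κ] :
    CardinalDirected I κ := by
  intro S hS
  have hS' : HasCardinalLT S κ := (hasCardinalLT_iff_cardinal_mk_lt _ _).2 hS
  exact ⟨IsCardinalFiltered.max (fun x : S => x.1) hS',
    fun j hj => leOfHom (IsCardinalFiltered.toMax (fun x : S => x.1) hS' ⟨j, hj⟩)⟩

end Directed

section Gen

variable {M : MorphismProperty K} {κ : Cardinal.{v}} {A : K}

lemma IsGenerated.exists_hom (hA : IsGenerated M κ A) {I : Type v} [Preorder I]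
    (hI : CardinalDirected I κ) {D : I ⥤ K} (hD : DiagramInM M D) {c : Cocone D}
    (hc : IsColimit c) (f : A ⟶ c.pt) : ∃ (i : I) (g : A ⟶ D.obj i), g ≫ c.ι.app i = f := by
  obtain ⟨h⟩ := hA I hI D hD c hc
  obtain ⟨i, g, hg⟩ := Types.jointly_surjective_of_isColimit h f
  exact ⟨i, g, hg⟩

lemma IsGenerated.exists_eq (hκ : κ.IsRegular) (hA : IsGenerated M κ A) {I : Type v} [Preorder I]
    (hI : CardinalDirected I κ) {D : I ⥤ K} (hD : DiagramInM M D) {c : Cocone D}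
    (hc : IsColimit c) {i j : I} (f : A ⟶ D.obj i) (g : A ⟶ D.obj j)
    (hfg : f ≫ c.ι.app i = g ≫ c.ι.app j) :
    ∃ (k : I) (hi : i ≤ k) (hj : j ≤ k),
      f ≫ D.map (homOfLE hi) = g ≫ D.map (homOfLE hj) := by
  obtain ⟨h⟩ := hA I hI D hD c hc
  have := hI.isFiltered hκ
  obtain ⟨k, u, v, huv⟩ := (Types.FilteredColimit.isColimit_eq_iff _ h (xi := f) (xj := g)).1 hfg
  exact ⟨k, leOfHom u, leOfHom v, huv⟩

lemma isGenerated_mk (hκ : κ.IsRegular)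
    (h₁ : ∀ (I : Type v) [Preorder I], CardinalDirected I κ → ∀ (D : I ⥤ K), DiagramInM M D →
      ∀ (c : Cocone D), IsColimit c → ∀ f : A ⟶ c.pt,
        ∃ (i : I) (g : A ⟶ D.obj i), g ≫ c.ι.app i = f)
    (h₂ : ∀ (I : Type v) [Preorder I], CardinalDirected I κ → ∀ (D : I ⥤ K), DiagramInM M D →
      ∀ (c : Cocone D), IsColimit c → ∀ (i j : I) (f : A ⟶ D.obj i) (g : A ⟶ D.obj j),
        f ≫ c.ι.app i = g ≫ c.ι.app j →
        ∃ (k : I) (hi : i ≤ k) (hj : j ≤ k),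
          f ≫ D.map (homOfLE hi) = g ≫ D.map (homOfLE hj)) :
    IsGenerated M κ A := by
  intro I _ hI D hD c hc
  have := hI.isFiltered hκ
  refine ⟨Types.FilteredColimit.isColimitOf _ _ ?_ ?_⟩
  · intro f
    obtain ⟨i, g, hg⟩ := h₁ I hI D hD c hc f
    exact ⟨i, g, hg.symm⟩
  · intro i j f g hfg
    obtain ⟨k, hi, hj, h⟩ := h₂ I hI D hD c hc i j f g hfg
    exact ⟨k, homOfLE hi, homOfLE hj, h⟩

/-- Passage from directed preorders to filtered categories. -/
lemma IsGenerated.isColimit_of_filtered [Fact κ.IsRegular] (hA : IsGenerated M κ A)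
    {J : Type v} [SmallCategory J] [IsCardinalFiltered J κ] (D : J ⥤ K)
    (hD : ∀ ⦃i j : J⦄ (f : i ⟶ j), M (D.map f)) (c : Cocone D) (hc : IsColimit c) :
    Nonempty (IsColimit ((coyoneda.obj (op A)).mapCocone c)) := by
  obtain ⟨α, _, _, Φ, _⟩ := IsCardinalFiltered.exists_cardinal_directed J κ
  obtain ⟨h⟩ := hA α cardinalDirected_of_isCardinalFiltered (Φ ⋙ D) (fun i j h => hD _)
    (c.whisker Φ) ((Functor.Final.isColimitWhiskerEquiv Φ c).symm hc)
  refine ⟨Functor.Final.isColimitWhiskerEquiv Φ _ ?_⟩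
  exact h

lemma IsGenerated.isCardinalPresentable [Fact κ.IsRegular]
    (hA : IsGenerated (⊤ : MorphismProperty K) κ A) : IsCardinalPresentable A κ where
  preservesColimitOfShape J _ _ := ⟨fun {D} => ⟨fun {c} hc =>
    hA.isColimit_of_filtered D (fun _ _ _ => trivial) c hc⟩⟩

lemma isGenerated_of_isCardinalPresentable [Fact κ.IsRegular] [IsCardinalPresentable A κ] :
    IsGenerated M κ A := by
  intro I _ hI D _ c hc
  have := hI.isCardinalFiltered
  have := preservesColimitsOfShape_of_isCardinalPresentable A κ I
  exact ⟨isColimitOfPreserves _ hc⟩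

end Gen

section EvEq

/-- Two morphisms to stages of a directed diagram which become equal at a later stage. -/
def EvEq {I : Type v} [Preorder I] (D : I ⥤ K) {B : K} {i j : I} (f : B ⟶ D.obj i)
    (g : B ⟶ D.obj j) : Prop :=
  ∃ (k : I) (hi : i ≤ k) (hj : j ≤ k), f ≫ D.map (homOfLE hi) = g ≫ D.map (homOfLE hj)

variable {I : Type v} [Preorder I] {D : I ⥤ K}

lemma map_trans (D : I ⥤ K) {i j k : I} (h : i ≤ j) (h' : j ≤ k) :
    D.map (homOfLE h) ≫ D.map (homOfLE h') = D.map (homOfLE (h.trans h')) := by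
  rw [← D.map_comp]; rfl

lemma map_trans_assoc (D : I ⥤ K) {i j k : I} (h : i ≤ j) (h' : j ≤ k) {Z : K}
    (z : D.obj k ⟶ Z) :
    D.map (homOfLE h) ≫ D.map (homOfLE h') ≫ z = D.map (homOfLE (h.trans h')) ≫ z := by
  rw [← map_trans D h h', Category.assoc]

lemma EvEq.refl {B : K} {i : I} (f : B ⟶ D.obj i) : EvEq D f f := ⟨i, le_rfl, le_rfl, rfl⟩

lemma EvEq.of_eq {B : K} {i : I} {f g : B ⟶ D.obj i} (h : f = g) : EvEq D f g :=
  h ▸ EvEq.refl f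

lemma EvEq.map {B : K} {i j : I} (f : B ⟶ D.obj i) (h : i ≤ j) :
    EvEq D f (f ≫ D.map (homOfLE h)) := ⟨j, h, le_rfl, by rw [Category.assoc, map_trans]⟩

lemma EvEq.symm {B : K} {i j : I} {f : B ⟶ D.obj i} {g : B ⟶ D.obj j} (h : EvEq D f g) :
    EvEq D g f := by
  obtain ⟨k, hi, hj, h⟩ := h
  exact ⟨k, hj, hi, h.symm⟩

lemma EvEq.precomp {A B : K} {i j : I} {f : B ⟶ D.obj i} {g : B ⟶ D.obj j} (h : EvEq D f g)
    (e : A ⟶ B) : EvEq D (e ≫ f) (e ≫ g) := by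
  obtain ⟨k, hi, hj, h⟩ := h
  exact ⟨k, hi, hj, by simp only [Category.assoc, h]⟩

lemma EvEq.trans [IsDirectedOrder I] {B : K} {i j k : I} {f : B ⟶ D.obj i} {g : B ⟶ D.obj j}
    {l : B ⟶ D.obj k} (h : EvEq D f g) (h' : EvEq D g l) : EvEq D f l := by
  obtain ⟨a, hi, hj, h⟩ := h
  obtain ⟨b, hi', hj', h'⟩ := h'
  obtain ⟨m, ha, hb⟩ := exists_ge_ge a b
  refine ⟨m, hi.trans ha, hj'.trans hb, ?_⟩
  rw [← map_trans D hi ha, ← map_trans D hj' hb, reassoc_of% h, ← reassoc_of% h', map_trans,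
    map_trans]

lemma EvEq.ι {B : K} {i j : I} {f : B ⟶ D.obj i} {g : B ⟶ D.obj j} (h : EvEq D f g)
    (c : Cocone D) : f ≫ c.ι.app i = g ≫ c.ι.app j := by
  obtain ⟨k, hi, hj, h⟩ := h
  rw [← c.w (homOfLE hi), ← c.w (homOfLE hj), reassoc_of% h]

/-- Hom-functors into a `κ`-directed diagram send `κ`-small colimits to limits. -/
lemma amalg {κ : Cardinal.{v}} (hI : CardinalDirected I κ)
    {J : Type*} [Category J] (hJ : HasCardinalLT (Arrow J) κ) {G : J ⥤ K} {c : Cocone G}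
    (hc : IsColimit c) (i : J → I) (f : ∀ a, G.obj a ⟶ D.obj (i a))
    (hf : ∀ ⦃a b : J⦄ (φ : a ⟶ b), EvEq D (G.map φ ≫ f b) (f a)) :
    ∃ (j : I) (hij : ∀ a, i a ≤ j) (x : c.pt ⟶ D.obj j),
      ∀ a, c.ι.app a ≫ x = f a ≫ D.map (homOfLE (hij a)) := by
  choose k hi hj h using fun φ : Arrow J => hf φ.hom
  obtain ⟨j, hkj⟩ := hI.exists_ge k hJ
  have hij : ∀ a, i a ≤ j := fun a => (hj (Arrow.mk (𝟙 a))).trans (hkj _)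
  let s : Cocone G :=
    { pt := D.obj j
      ι :=
        { app := fun a => f a ≫ D.map (homOfLE (hij a))
          naturality := by
            intro a b φ
            have := h (Arrow.mk φ) =≫ D.map (homOfLE (hkj (Arrow.mk φ)))
            simp only [Category.assoc, map_trans] at this
            simpa using this } }
  exact ⟨j, hij, hc.desc s, fun a => hc.fac s a⟩

end EvEq

section Closure

variable {M : MorphismProperty K} {κ : Cardinal.{v}}

lemma isGenerated_of_isColimit (hκ : κ.IsRegular) {J : Type*} [Category J]
    (hJ : HasCardinalLT (Arrow J) κ) {G : J ⥤ K} {t : Cocone G} (ht : IsColimit t)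
    (hG : ∀ a, IsGenerated M κ (G.obj a)) : IsGenerated M κ t.pt := by
  refine isGenerated_mk hκ ?_ ?_
  · intro I _ hI D hD c hc f
    choose i g hg using fun a => (hG a).exists_hom hI hD hc (t.ι.app a ≫ f)
    obtain ⟨j, hij, x, hx⟩ := amalg hI hJ ht i g (fun a b φ => by
      refine (hG a).exists_eq hκ hI hD hc _ _ ?_
      simp [hg])
    refine ⟨j, x, ht.hom_ext fun a => ?_⟩
    rw [reassoc_of% (hx a), c.w, hg]
  · intro I _ hI D hD c hc i j f g hfg
    choose k hi hj h using fun a => (hG a).exists_eq hκ hI hD hc (t.ι.app a ≫ f)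
      (t.ι.app a ≫ g) (by simp [hfg])
    have := hI.isDirectedOrder hκ
    obtain ⟨l₀, hi₀, hj₀⟩ := exists_ge_ge i j
    obtain ⟨l₁, hl₁⟩ := hI.exists_ge k (hasCardinalLT_of_hasCardinalLT_arrow hJ)
    obtain ⟨l, h₀, h₁⟩ := exists_ge_ge l₀ l₁
    refine ⟨l, hi₀.trans h₀, hj₀.trans h₀, ht.hom_ext fun a => ?_⟩
    have := h a =≫ D.map (homOfLE ((hl₁ a).trans h₁))
    simpa only [Category.assoc, map_trans] using this

lemma isGenerated_of_iso (hκ : κ.IsRegular) {A B : K} (e : A ≅ B) (hA : IsGenerated M κ A) :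
    IsGenerated M κ B := by
  refine isGenerated_mk hκ ?_ ?_
  · intro I _ hI D hD c hc f
    obtain ⟨i, g, hg⟩ := hA.exists_hom hI hD hc (e.hom ≫ f)
    exact ⟨i, e.inv ≫ g, by simp [hg]⟩
  · intro I _ hI D hD c hc i j f g hfg
    obtain ⟨k, hi, hj, h⟩ := hA.exists_eq hκ hI hD hc (e.hom ≫ f) (e.hom ≫ g) (by simp [hfg])
    exact ⟨k, hi, hj, by simpa using h⟩

lemma isGenerated_of_E (F : FactorizationSystem K) (hκ : κ.IsRegular) (hF : Convenient F κ)
    (hE : ∀ {A B : K} (e : A ⟶ B), F.E e → Epi e)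
    {A B : K} (e : A ⟶ B) (he : F.E e) (hA : IsGenerated F.M κ A) : IsGenerated F.M κ B := by
  have := hE e he
  refine isGenerated_mk hκ ?_ ?_
  · intro I _ hI D hD c hc f
    obtain ⟨i, g, hg⟩ := hA.exists_hom hI hD hc (e ≫ f)
    obtain ⟨d, ⟨-, hd⟩, -⟩ := F.orth e (c.ι.app i) he (hF.M_cocone I hI D hD c hc i) g f hg
    exact ⟨i, d, hd⟩
  · intro I _ hI D hD c hc i j f g hfg
    obtain ⟨k, hi, hj, h⟩ := hA.exists_eq hκ hI hD hc (e ≫ f) (e ≫ g) (by simp [hfg])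
    exact ⟨k, hi, hj, by simpa only [Category.assoc, cancel_epi] using h⟩

end Closure

section Epi

variable (F : FactorizationSystem K)

lemma E_of_uniqueLift {A B : K} (f : A ⟶ B)
    (hf : ∀ {X Y : K} (m : X ⟶ Y), F.M m → UniqueLift f m) : F.E f := by
  obtain ⟨C, e, m, he, hm, rfl⟩ := F.factor f
  obtain ⟨d, ⟨h₁, h₂⟩, -⟩ := hf m hm e (𝟙 _) (by simp)
  have h₃ : m ≫ d = 𝟙 _ :=
    (F.orth e m he hm e m rfl).unique ⟨by simpa using h₁, by simp [h₂]⟩ ⟨by simp, by simp⟩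
  exact F.E_comp _ _ he (F.E_iso _ ⟨d, h₃, h₂⟩)

lemma E_widePushout [HasColimits K] {A B : K} (e : A ⟶ B) (he : F.E e) (α : Type v) :
    F.E (WidePushout.head (B := A) (objs := fun _ : α => B) (fun _ => e)) := by
  refine E_of_uniqueLift F _ ?_
  intro X Y m hm u w huw
  have harr : ∀ i : α, e ≫ WidePushout.ι (fun _ : α => e) i = WidePushout.head (fun _ : α => e) :=
    fun i => WidePushout.arrow_ι (fun _ : α => e) i
  have key : ∀ i : α, ∃! d : B ⟶ X,
      e ≫ d = u ∧ d ≫ m = WidePushout.ι (fun _ : α => e) i ≫ w :=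
    fun i => F.orth e m he hm u _ (by rw [huw, reassoc_of% (harr i)])
  choose d hd hd' using key
  have hhead : WidePushout.head (fun _ : α => e) ≫ WidePushout.desc u d (fun i => (hd i).1) = u :=
    WidePushout.head_desc (fun _ : α => e) u d (fun i => (hd i).1)
  have hι : ∀ i, WidePushout.ι (fun _ : α => e) i ≫ WidePushout.desc u d (fun i => (hd i).1) =
      d i := fun i => WidePushout.ι_desc (fun _ : α => e) u d (fun i => (hd i).1) i
  refine ⟨WidePushout.desc u d (fun i => (hd i).1), ⟨hhead, ?_⟩, ?_⟩
  · apply WidePushout.hom_ext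
    · intro i
      rw [reassoc_of% (hι i)]
      exact (hd i).2
    · rw [reassoc_of% hhead, huw]
  · rintro d' ⟨h₁, h₂⟩
    apply WidePushout.hom_ext
    · intro i
      rw [hι]
      exact hd' i _ ⟨by rw [reassoc_of% (harr i), h₁], by rw [Category.assoc, h₂]⟩
    · rw [hhead, h₁]

lemma quotientRel_of_eq {E : MorphismProperty K} {A : K} {p q : Σ B : K, {e : A ⟶ B // E e}}
    (h : Quot.mk (QuotientRel E A) p = Quot.mk (QuotientRel E A) q) : QuotientRel E A p q := by
  have heq : Equivalence (QuotientRel E A) :=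
    { refl := fun p => ⟨Iso.refl _, by simp⟩
      symm := fun ⟨i, hi⟩ => ⟨i.symm, by simp [← hi]⟩
      trans := fun ⟨i, hi⟩ ⟨j, hj⟩ => ⟨i ≪≫ j, by simp [← hj, ← hi]⟩ }
  exact heq.eqvGen_iff.1 (Quot.eqvGen_exact h)

lemma epi_of_E [HasColimits K] {κ : Cardinal.{v}} (hF : Convenient F κ)
    {A B : K} (e : A ⟶ B) (he : F.E e) : Epi e := by
  refine ⟨fun {Z} u w huw => ?_⟩
  by_contra hne
  have := hF.cowellpowered A
  let T := Shrink.{v} (Quot (QuotientRel F.E A))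
  let rep : T → Σ B : K, {e : A ⟶ B // F.E e} := fun t => ((equivShrink _).symm t).out
  let α : Type v := Set (Σ t : T, (B ⟶ (rep t).1))
  let P : K := widePushout A (fun _ : α => B) (fun _ => e)
  let p : Σ B : K, {e : A ⟶ B // F.E e} := ⟨P, WidePushout.head _, E_widePushout F e he α⟩
  let t : T := equivShrink _ (Quot.mk _ p)
  obtain ⟨i, -⟩ : QuotientRel F.E A p (rep t) := by
    apply quotientRel_of_eq
    simp [rep, t]
  refine Function.cantor_injective (α := Σ t : T, (B ⟶ (rep t).1))
    (fun a : α => ⟨t, WidePushout.ι (fun _ => e) a ≫ i.hom⟩) ?_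
  intro a b hab
  by_contra hne'
  have h₁ : WidePushout.ι (fun _ : α => e) a ≫ i.hom = WidePushout.ι (fun _ : α => e) b ≫ i.hom := by
    simpa using hab
  have h₂ : WidePushout.ι (fun _ : α => e) a = WidePushout.ι (fun _ : α => e) b := by
    simpa using h₁ =≫ i.inv
  classical
  let s : P ⟶ Z := WidePushout.desc (e ≫ u) (fun k : α => if k = a then u else w)
    (fun k => by
      split_ifs
      · rfl
      · exact huw.symm)
  have h₃ := h₂ =≫ s
  simp only [s, WidePushout.ι_desc] at h₃
  rw [if_pos trivial, if_neg (fun h => hne' h.symm)] at h₃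
  exact hne h₃

/-- `A` has fewer than `μ` quotients. -/
def QBound (μ : Cardinal.{v}) (A : K) : Prop :=
  ∃ (T : Type v) (B : T → K) (e : ∀ t, A ⟶ B t), Cardinal.mk T < μ ∧
    ∀ (B' : K) (e' : A ⟶ B'), F.E e' → ∃ (t : T) (i : B t ≅ B'), e t ≫ i.hom = e'

variable {F} in
lemma QBound.of_iso {μ : Cardinal.{v}} {A A' : K} (h : QBound F μ A) (i : A ≅ A') :
    QBound F μ A' := by
  obtain ⟨T, B, e, hT, he⟩ := h
  refine ⟨T, B, fun t => i.inv ≫ e t, hT, fun B' e' he' => ?_⟩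
  obtain ⟨t, j, hj⟩ := he B' (i.hom ≫ e') (F.E_comp _ _ (F.E_iso _ inferInstance) he')
  exact ⟨t, j, by simp [hj]⟩

lemma qBound_of_lt {κ μ : Cardinal.{v}} (hF : Convenient F κ) (A : K)
    (hμ : letI := hF.cowellpowered A
      Cardinal.mk (Shrink.{v} (Quot (QuotientRel F.E A))) < μ) : QBound F μ A := by
  have := hF.cowellpowered A
  refine ⟨_, fun t => ((equivShrink (Quot (QuotientRel F.E A))).symm t).out.1,
    fun t => ((equivShrink (Quot (QuotientRel F.E A))).symm t).out.2.1, hμ, ?_⟩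
  intro B' e' he'
  have : QuotientRel F.E A
    ((equivShrink (Quot (QuotientRel F.E A))).symm
      (equivShrink _ (Quot.mk _ ⟨B', e', he'⟩))).out ⟨B', e', he'⟩ := by
    apply quotientRel_of_eq
    simp
  obtain ⟨i, hi⟩ := this
  exact ⟨_, i, hi⟩

end Epi

section Min

variable (F : FactorizationSystem K) {I : Type v} [Preorder I] (D : I ⥤ K)

/-- A germ of morphisms not factorizing through a proper quotient. -/
def Minimal' {B : K} {j : I} (m : B ⟶ D.obj j) : Prop :=
  ∀ (B' : K) (e : B ⟶ B') (j' : I) (z : B' ⟶ D.obj j'), F.E e → EvEq D m (e ≫ z) → IsIso e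

variable {F D}

lemma Minimal'.of_iso {B B' : K} {j : I} {m : B ⟶ D.obj j} (hm : Minimal' F D m) (i : B' ≅ B) :
    Minimal' F D (i.hom ≫ m) := by
  intro C e j' z he h
  have := hm C (i.inv ≫ e) j' z (F.E_comp _ _ (F.E_iso _ inferInstance) he)
    (by simpa using h.precomp i.inv)
  have h2 : e = i.hom ≫ i.inv ≫ e := by simp
  rw [h2]
  infer_instance

lemma exists_minimal {μ : Cardinal.{v}} (hμ : μ.IsRegular) (hI : CardinalDirected I μ)
    (hE : ∀ {A B : K} (e : A ⟶ B), F.E e → Epi e) {A : K} (hA : QBound F μ A) {i : I}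
    (f : A ⟶ D.obj i) :
    ∃ (j : I) (hij : i ≤ j) (B : K) (e : A ⟶ B) (m : B ⟶ D.obj j),
      F.E e ∧ Minimal' F D m ∧ f ≫ D.map (homOfLE hij) = e ≫ m := by
  have := hI.isDirectedOrder hμ
  obtain ⟨T, Q, q, hT, hq⟩ := hA
  let T' := {t : T // ∃ (k : I) (z : Q t ⟶ D.obj k), EvEq D f (q t ≫ z)}
  have hT' : HasCardinalLT T' μ :=
    ((hasCardinalLT_iff_cardinal_mk_lt _ _).2 hT).of_injective Subtype.val Subtype.val_injective
  choose k z hz using fun t : T' => t.2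
  choose k' hk₁ hk₂ hk using hz
  obtain ⟨j₀, hj₀⟩ := hI.exists_ge k' hT'
  obtain ⟨j, hij, hj⟩ := exists_ge_ge i j₀
  obtain ⟨B, e, m, he, hm, hem⟩ := F.factor (f ≫ D.map (homOfLE hij))
  refine ⟨j, hij, B, e, m, he, ?_, hem.symm⟩
  intro B' e' j' y he' hy
  have h1 : EvEq D f (e ≫ e' ≫ y) :=
    ((EvEq.map f hij).trans (EvEq.of_eq hem.symm)).trans (hy.precomp e)
  obtain ⟨t, a, ha⟩ := hq B' (e ≫ e') (F.E_comp _ _ he he')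
  let t' : T' := ⟨t, j', a.hom ≫ y, by
    rw [← Category.assoc, ha, Category.assoc]; exact h1⟩
  have h2 := hk t' =≫ D.map (homOfLE ((hj₀ t').trans hj))
  simp only [Category.assoc, map_trans] at h2
  have h3 : q t = e ≫ e' ≫ a.inv := by simp [← reassoc_of% ha]
  have hepi := hE e he
  have hepi' := hE e' he'
  have h4 : m = e' ≫ a.inv ≫ z t' ≫ D.map (homOfLE ((hk₂ t').trans ((hj₀ t').trans hj))) := by
    rw [← cancel_epi e, hem]
    refine h2.trans ?_
    change q t ≫ _ = _
    rw [h3]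
    simp only [Category.assoc]
  obtain ⟨d, ⟨hd, -⟩, -⟩ := F.orth e' m he' hm (𝟙 _) _ (by rw [Category.id_comp]; exact h4)
  exact ⟨d, hd, by rw [← cancel_epi e', reassoc_of% hd, Category.comp_id]⟩

variable (F D)

/-- The category of minimal germs. -/
structure El {ι : Type v} (obj : ι → K) : Type v where
  a : ι
  i : I
  f : obj a ⟶ D.obj i
  min : Minimal' F D f

/-- Morphisms of minimal germs. -/
@[ext]
structure El.Hom {ι : Type v} {obj : ι → K} (x y : El F D obj) : Type v where
  h : obj x.a ⟶ obj y.a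
  w : EvEq D x.f (h ≫ y.f)

instance [IsDirectedOrder I] {ι : Type v} (obj : ι → K) : SmallCategory (El F D obj) where
  Hom x y := El.Hom F D x y
  id x := ⟨𝟙 _, EvEq.of_eq (by simp)⟩
  comp f g := ⟨f.h ≫ g.h, f.w.trans (by simpa using g.w.precomp f.h)⟩
  id_comp f := El.Hom.ext (Category.id_comp _)
  comp_id f := El.Hom.ext (Category.comp_id _)
  assoc f g h := El.Hom.ext (Category.assoc _ _ _)

/-- The forgetful functor. -/
def El.U [IsDirectedOrder I] {ι : Type v} (obj : ι → K) : El F D obj ⥤ K where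
  obj x := obj x.a
  map f := f.h
  map_id _ := rfl
  map_comp _ _ := rfl

lemma El.map_mem [IsDirectedOrder I] {ι : Type v} (obj : ι → K) {x y : El F D obj} (f : x ⟶ y) :
    F.M ((El.U F D obj).map f) := by
  obtain ⟨C, e, m, he, hm, hem⟩ := F.factor (f.h)
  have := x.min C e y.i (m ≫ y.f) he (by
    rw [← Category.assoc, hem]; exact f.w)
  change F.M f.h
  rw [← hem]
  exact F.M_comp _ _ (F.M_iso _ this) hm

end Min

section Dense

variable {F : FactorizationSystem K} {κ : Cardinal.{v}} {S : Set K}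

/-- The generated objects form a dense subcategory. -/
lemma exists_hom_of_natural (h : IsLocallyGenerated F κ S) (Y X : K)
    (ψ : ∀ (B : K), IsGenerated F.M κ B → (B ⟶ Y) → (B ⟶ X))
    (hψ : ∀ (B B' : K) (hB : IsGenerated F.M κ B) (hB' : IsGenerated F.M κ B') (k : B' ⟶ B)
      (g : B ⟶ Y), ψ B' hB' (k ≫ g) = k ≫ ψ B hB g) :
    ∃ u : Y ⟶ X, ∀ (B : K) (hB : IsGenerated F.M κ B) (g : B ⟶ Y), g ≫ u = ψ B hB g := by
  obtain ⟨p⟩ := h.presentation Y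
  obtain ⟨T, hT, D, hmem, hM, c, rfl, hc⟩ := p
  let s : Cocone D :=
    { pt := X
      ι :=
        { app := fun t => ψ _ (h.gen _ (hmem t)) (c.ι.app t)
          naturality := by
            intro t t' φ
            rw [← hψ _ _ (h.gen _ (hmem t')) (h.gen _ (hmem t)), c.w]
            simp } }
  refine ⟨hc.desc s, fun B hB g => ?_⟩
  obtain ⟨t, l, rfl⟩ := hB.exists_hom hT hM hc g
  rw [Category.assoc, hc.fac, hψ _ _ (h.gen _ (hmem t)) hB]

lemma hom_ext_generated (h : IsLocallyGenerated F κ S) {Y X : K} (u w : Y ⟶ X)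
    (huw : ∀ (B : K), IsGenerated F.M κ B → ∀ g : B ⟶ Y, g ≫ u = g ≫ w) : u = w := by
  obtain ⟨p⟩ := h.presentation Y
  obtain ⟨T, hT, D, hmem, hM, c, rfl, hc⟩ := p
  exact hc.hom_ext fun t => huw _ (h.gen _ (hmem t)) _

lemma essentiallySmall_generated (h : IsLocallyGenerated F κ S) :
    ∃ (ι : Type v) (obj : ι → K), (∀ a, IsGenerated F.M κ (obj a)) ∧
      ∀ B, IsGenerated F.M κ B → ∃ a, Nonempty (B ≅ obj a) := by
  let P : ObjectProperty K := fun X => X ∈ S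
  have : ObjectProperty.Small.{v} P := h.small
  let G : ObjectProperty K := fun X => IsGenerated F.M κ X
  have hG : G ≤ P.retractClosure := by
    intro B hB
    obtain ⟨p⟩ := h.presentation B
    obtain ⟨T, hT, D, hmem, hM, c, rfl, hc⟩ := p
    obtain ⟨t, g, hg⟩ := IsGenerated.exists_hom hB hT hM hc (𝟙 _)
    exact ⟨_, hmem t, ⟨⟨g, c.ι.app t, hg⟩⟩⟩
  have : ObjectProperty.EssentiallySmall.{v} G := .of_le hG
  obtain ⟨Q, _, hQ, hQ'⟩ := ObjectProperty.EssentiallySmall.exists_small_le.{v} G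
  refine ⟨Shrink.{v} (Subtype Q), fun a => ((equivShrink _).symm a).1,
    fun a => hQ _ ((equivShrink _).symm a).2, fun B hB => ?_⟩
  obtain ⟨Y, hY, ⟨e⟩⟩ := hQ' _ hB
  exact ⟨equivShrink _ ⟨Y, hY⟩, ⟨e ≪≫ eqToIso (by simp)⟩⟩

end Dense

section Main

variable {F : FactorizationSystem K} {κ μ : Cardinal.{v}} {S : Set K}
  {I : Type v} [Preorder I] {D : I ⥤ K} {ι : Type v} {obj : ι → K}

lemma exists_el (hκ : κ.IsRegular) (h : IsLocallyGenerated F κ S) (hμ : μ.IsRegular)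
    (hQ : ∀ B, IsGenerated F.M κ B → QBound F μ B)
    (hobj : ∀ B, IsGenerated F.M κ B → ∃ a, Nonempty (B ≅ obj a))
    (hI : CardinalDirected I μ) {B : K} (hB : IsGenerated F.M κ B) {i : I} (f : B ⟶ D.obj i) :
    ∃ (y : El F D obj) (l : B ⟶ obj y.a), EvEq D f (l ≫ y.f) := by
  have := h.hasColimits
  have hE : ∀ {A B : K} (e : A ⟶ B), F.E e → Epi e := fun e he => epi_of_E F h.convenient e he
  obtain ⟨j, hij, C, e, m, he, hm, hem⟩ := exists_minimal hμ hI hE (hQ B hB) f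
  obtain ⟨a, ⟨s⟩⟩ := hobj C (isGenerated_of_E F hκ h.convenient hE e he hB)
  exact ⟨⟨a, j, s.inv ≫ m, hm.of_iso s.symm⟩, e ≫ s.hom,
    ⟨j, hij, le_rfl, by simp [hem]⟩⟩

lemma evEq_step [IsDirectedOrder I] {A P Z : K} {i j k : I} {f : A ⟶ D.obj i} (hij : i ≤ j)
    {x : P ⟶ D.obj j} {m : P ⟶ Z} {z : Z ⟶ D.obj k} (hm : EvEq D x (m ≫ z)) (q : A ⟶ P)
    (hq : q ≫ x = f ≫ D.map (homOfLE hij)) : EvEq D f ((q ≫ m) ≫ z) := by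
  refine (EvEq.map f hij).trans ?_
  rw [← hq, Category.assoc]
  exact hm.precomp q

lemma el_isCardinalFiltered [Fact κ.IsRegular] (h : IsLocallyGenerated F κ S) (hμ : μ.IsRegular)
    (hκμ : κ ≤ μ) (hQ : ∀ B, IsGenerated F.M κ B → QBound F μ B)
    (hobj' : ∀ a, IsGenerated F.M κ (obj a))
    (hobj : ∀ B, IsGenerated F.M κ B → ∃ a, Nonempty (B ≅ obj a))
    (hI : CardinalDirected I μ) [IsDirectedOrder I] : IsCardinalFiltered (El F D obj) κ where
  nonempty_cocone {A} _ G hA := by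
    have hκ : κ.IsRegular := Fact.out
    have := h.hasColimits
    let c := colimit.cocone (G ⋙ El.U F D obj)
    have hc : IsColimit c := colimit.isColimit _
    obtain ⟨j, hij, x, hx⟩ := amalg (D := D) hI (hA.of_le hκμ) hc (fun a => (G.obj a).i)
      (fun a => (G.obj a).f) (fun a b φ => (G.map φ).w.symm)
    have hgen : IsGenerated F.M κ c.pt :=
      isGenerated_of_isColimit hκ hA hc (fun a => hobj' _)
    obtain ⟨y, l, hl⟩ := exists_el hκ h hμ hQ hobj hI hgen x
    refine ⟨⟨y, ⟨fun a => ⟨c.ι.app a ≫ l, ?_⟩, ?_⟩⟩⟩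
    · exact evEq_step (hij a) hl (c.ι.app a) (hx a)
    · intro a b φ
      apply El.Hom.ext
      have := c.w φ =≫ l
      change (G.map φ).h ≫ c.ι.app b ≫ l = (c.ι.app a ≫ l) ≫ 𝟙 _
      rw [Category.comp_id, ← this, Category.assoc]
      rfl

lemma el_wd [IsDirectedOrder I] (hκ : κ.IsRegular) (h : IsLocallyGenerated F κ S)
    (hμ : μ.IsRegular)
    (hQ : ∀ B, IsGenerated F.M κ B → QBound F μ B)
    (hobj' : ∀ a, IsGenerated F.M κ (obj a))
    (hobj : ∀ B, IsGenerated F.M κ B → ∃ a, Nonempty (B ≅ obj a))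
    (hI : CardinalDirected I μ) {X : K} (p : ∀ y : El F D obj, obj y.a ⟶ X)
    (hp : ∀ (y y' : El F D obj) (φ : y ⟶ y'), φ.h ≫ p y' = p y)
    {B : K} (hB : IsGenerated F.M κ B) {y y' : El F D obj} (l : B ⟶ obj y.a) (l' : B ⟶ obj y'.a)
    (hll' : EvEq D (l ≫ y.f) (l' ≫ y'.f)) : l ≫ p y = l' ≫ p y' := by
  have := h.hasColimits
  obtain ⟨k, hi, hj, e⟩ := hll'
  simp only [Category.assoc] at e
  have hP : IsGenerated F.M κ (pushout l l') :=
    isGenerated_of_isColimit hκ (hasCardinalLT_of_finite _ _ hκ.aleph0_le)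
      (colimit.isColimit (span l l')) (by
        rintro (_ | _ | _)
        · exact hB
        · exact hobj' _
        · exact hobj' _)
  obtain ⟨z, m, hm⟩ := exists_el hκ h hμ hQ hobj hI hP (pushout.desc _ _ e)
  let φ : y ⟶ z := ⟨pushout.inl l l' ≫ m,
    evEq_step hi hm (pushout.inl l l') (pushout.inl_desc _ _ _)⟩
  let φ' : y' ⟶ z := ⟨pushout.inr l l' ≫ m,
    evEq_step hj hm (pushout.inr l l') (pushout.inr_desc _ _ _)⟩
  rw [← hp _ _ φ, ← hp _ _ φ']
  change l ≫ (pushout.inl l l' ≫ m) ≫ _ = l' ≫ (pushout.inr l l' ≫ m) ≫ _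
  simp only [Category.assoc]
  rw [pushout.condition_assoc]

lemma exists_el_colimit [Fact κ.IsRegular] (h : IsLocallyGenerated F κ S) (hμ : μ.IsRegular)
    (hκμ : κ ≤ μ) (hQ : ∀ B, IsGenerated F.M κ B → QBound F μ B)
    (hobj' : ∀ a, IsGenerated F.M κ (obj a))
    (hobj : ∀ B, IsGenerated F.M κ B → ∃ a, Nonempty (B ≅ obj a))
    (hI : CardinalDirected I μ) [IsDirectedOrder I] :
    ∃ (X : K) (p : ∀ y : El F D obj, obj y.a ⟶ X),
      (∀ (y y' : El F D obj) (φ : y ⟶ y'), φ.h ≫ p y' = p y) ∧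
      (∀ (Z : K) (q : ∀ y : El F D obj, obj y.a ⟶ Z),
        (∀ (y y' : El F D obj) (φ : y ⟶ y'), φ.h ≫ q y' = q y) →
        ∃ s : X ⟶ Z, ∀ y, p y ≫ s = q y) ∧
      ∀ B, IsGenerated F.M κ B →
        (∀ f : B ⟶ X, ∃ (y : El F D obj) (g : B ⟶ obj y.a), g ≫ p y = f) ∧
        (∀ (y y' : El F D obj) (g : B ⟶ obj y.a) (g' : B ⟶ obj y'.a),
          g ≫ p y = g' ≫ p y' → EvEq D (g ≫ y.f) (g' ≫ y'.f)) := by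
  have := h.hasColimits
  have := el_isCardinalFiltered (D := D) h hμ hκμ hQ hobj' hobj hI
  have hfil := isFiltered_of_isCardinalFiltered (El F D obj) κ
  let t := colimit.cocone (El.U F D obj)
  have ht : IsColimit t := colimit.isColimit _
  refine ⟨t.pt, fun y => t.ι.app y, fun y y' φ => t.w φ, fun Z q hq => ?_, fun B hB => ?_⟩
  · let c : Cocone (El.U F D obj) :=
      { pt := Z
        ι :=
          { app := q
            naturality := fun y y' φ => (hq y y' φ).trans (Category.comp_id (q y)).symm } }
    exact ⟨ht.desc c, fun y => ht.fac c y⟩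
  · obtain ⟨ht₀⟩ := hB.isColimit_of_filtered (El.U F D obj)
      (fun _ _ f => El.map_mem F D obj f) t ht
    constructor
    · intro f
      obtain ⟨y, g, hg⟩ := Types.jointly_surjective_of_isColimit ht₀ f
      exact ⟨y, g, hg⟩
    · intro y y' g g' hgg
      obtain ⟨k, a, b, hab⟩ := (Types.FilteredColimit.isColimit_eq_iff _ ht₀
        (xi := g) (xj := g')).1 hgg
      change g ≫ a.h = g' ≫ b.h at hab
      have h2 : EvEq D (g ≫ y.f) ((g ≫ a.h) ≫ k.f) := by
        rw [Category.assoc]; exact a.w.precomp g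
      have h3 : EvEq D (g' ≫ y'.f) ((g' ≫ b.h) ≫ k.f) := by
        rw [Category.assoc]; exact b.w.precomp g'
      rw [hab] at h2
      exact h2.trans h3.symm

theorem isGenerated_top (hκ : κ.IsRegular) (h : IsLocallyGenerated F κ S)
    (hμ : μ.IsRegular) (hκμ : κ ≤ μ)
    (hQ : ∀ B, IsGenerated F.M κ B → QBound F μ B)
    (hobj' : ∀ a, IsGenerated F.M κ (obj a))
    (hobj : ∀ B, IsGenerated F.M κ B → ∃ a, Nonempty (B ≅ obj a))
    {B₀ : K} (hB₀ : IsGenerated F.M κ B₀) : IsGenerated (⊤ : MorphismProperty K) μ B₀ := by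
  have := h.hasColimits
  have : Fact κ.IsRegular := ⟨hκ⟩
  suffices key : ∀ (I : Type v) [Preorder I], CardinalDirected I μ → ∀ (D : I ⥤ K)
      (c : Cocone D), IsColimit c → (∀ f : B₀ ⟶ c.pt,
        ∃ (i : I) (g : B₀ ⟶ D.obj i), g ≫ c.ι.app i = f) ∧
        (∀ (i j : I) (f : B₀ ⟶ D.obj i) (g : B₀ ⟶ D.obj j),
        f ≫ c.ι.app i = g ≫ c.ι.app j → EvEq D f g) from
    isGenerated_mk hμ (fun I _ hI D _ c hc => (key I hI D c hc).1)
      (fun I _ hI D _ c hc => (key I hI D c hc).2)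
  intro I _ hI D c hc
  have := hI.isDirectedOrder hμ
  obtain ⟨X, p, hp, hdesc, hX⟩ := exists_el_colimit (D := D) h hμ hκμ hQ hobj' hobj hI
  have wd : ∀ {B : K} (_ : IsGenerated F.M κ B) {y y' : El F D obj} (l : B ⟶ obj y.a)
    (l' : B ⟶ obj y'.a), EvEq D (l ≫ y.f) (l' ≫ y'.f) → l ≫ p y = l' ≫ p y' :=
    fun hB _ _ l l' hl => el_wd hκ h hμ hQ hobj' hobj hI p hp hB l l' hl
  choose y l hl using fun (i : I) (B : K) (hB : IsGenerated F.M κ B) (f : B ⟶ D.obj i) =>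
    exists_el hκ h hμ hQ hobj hI hB f
  choose u hu using fun i : I => exists_hom_of_natural h (D.obj i) X
    (fun B hB f => l i B hB f ≫ p (y i B hB f))
    (fun B B' hB hB' k g => by
      rw [← Category.assoc]
      refine wd hB' _ _ ((hl i B' hB' (k ≫ g)).symm.trans ?_)
      rw [Category.assoc]
      exact (hl i B hB g).precomp k)
  let r : c.pt ⟶ X := hc.desc
    { pt := X
      ι :=
        { app := u
          naturality := by
            intro i j φ
            simp only [Functor.const_obj_obj, Functor.const_obj_map, Category.comp_id]
            refine hom_ext_generated h _ _ fun B hB g => ?_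
            rw [← Category.assoc, hu j B hB, hu i B hB]
            refine wd hB _ _ ((hl j B hB _).symm.trans (EvEq.trans ?_ (hl i B hB g)))
            exact (EvEq.map g (leOfHom φ)).symm } }
  have hr : ∀ i, c.ι.app i ≫ r = u i := fun i => hc.fac _ i
  obtain ⟨s, hs⟩ := hdesc c.pt (fun y => y.f ≫ c.ι.app y.i) (fun y y' φ => by
    rw [← Category.assoc]; exact (φ.w.ι c).symm)
  have hrs : r ≫ s = 𝟙 _ := by
    refine hc.hom_ext fun i => ?_
    rw [← Category.assoc, hr, Category.comp_id]
    refine hom_ext_generated h _ _ fun B hB g => ?_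
    rw [← Category.assoc, hu i B hB, Category.assoc, hs, ← Category.assoc]
    exact ((hl i B hB g).ι c).symm
  constructor
  · intro f
    obtain ⟨y, g, hg⟩ := (hX B₀ hB₀).1 (f ≫ r)
    refine ⟨y.i, g ≫ y.f, ?_⟩
    have := hg =≫ s
    rw [Category.assoc, Category.assoc, hrs, Category.comp_id, hs] at this
    rw [Category.assoc]
    exact this
  · intro i j f g hfg
    have h1 := hfg =≫ r
    rw [Category.assoc, Category.assoc, hr, hr, hu i _ hB₀, hu j _ hB₀] at h1
    exact ((hl i _ hB₀ f).trans ((hX B₀ hB₀).2 _ _ _ _ h1)).trans (hl j _ hB₀ g).symm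

end Main

/-- If `K` is `M`-locally generated w.r.t. some convenient factorization
system `(E, M)` then `K` is locally presentable (locally μ-presentable for some regular
cardinal μ, possibly larger than λ). -/
theorem locallyGenerated_implies_locallyPresentable
    (F : FactorizationSystem K)
    (h : ∃ κ : Cardinal.{v}, κ.IsRegular ∧ ∃ S : Set K, IsLocallyGenerated F κ S) :
    ∃ μ : Cardinal.{v}, μ.IsRegular ∧ LocallyPresentable K μ := by
  obtain ⟨κ, hκ, S, h⟩ := h
  obtain ⟨ι, obj, hobj', hobj⟩ := essentiallySmall_generated h
  have := h.hasColimits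
  have hcow := h.convenient.cowellpowered
  let Q : Type v := Σ a : ι, Shrink.{v} (Quot (QuotientRel F.E (obj a)))
  let μ : Cardinal.{v} := Order.succ (max κ (Cardinal.mk Q))
  have hμ : μ.IsRegular := Cardinal.isRegular_succ (hκ.aleph0_le.trans (le_max_left _ _))
  have hκμ : κ ≤ μ := (le_max_left _ _).trans (Order.le_succ _)
  have hQ : ∀ B, IsGenerated F.M κ B → QBound F μ B := by
    intro B hB
    obtain ⟨a, ⟨e⟩⟩ := hobj B hB
    refine QBound.of_iso (qBound_of_lt F h.convenient (obj a) ?_) e.symm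
    refine lt_of_le_of_lt ?_ (Order.lt_succ (max κ (Cardinal.mk Q)))
    refine le_trans ?_ (le_max_right _ _)
    exact Cardinal.mk_le_of_injective (f := fun q => (⟨a, q⟩ : Q))
      (fun q q' hqq => eq_of_heq (Sigma.mk.inj hqq).2)
  have hgen : ∀ B, IsGenerated F.M κ B → IsGenerated (⊤ : MorphismProperty K) μ B :=
    fun B hB => isGenerated_top hκ h hμ hκμ hQ hobj' hobj hB
  refine ⟨μ, hμ, inferInstance, ?_⟩
  have : Fact μ.IsRegular := ⟨hμ⟩
  let P : ObjectProperty K := fun X => X ∈ S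
  have hP : ObjectProperty.Small.{v} P := h.small
  have hP₁ : P.IsStrongGenerator := by
    refine ObjectProperty.IsStrongGenerator.mk_of_exists_colimitsOfShape.{v, v} fun X => ?_
    obtain ⟨T, hT, D, hmem, hM, c, rfl, hc⟩ := (h.presentation X).some
    exact ⟨T, inferInstance, ⟨{ diag := D, ι := c.ι, isColimit := hc, prop_diag_obj := hmem }⟩⟩
  have hP₂ : P ≤ isCardinalPresentable K μ := fun X hX =>
    (hgen X (h.gen X hX)).isCardinalPresentable
  have : IsCardinalLocallyPresentable K μ :=
    (IsCardinalLocallyPresentable.iff_exists_isStrongGenerator K μ).2 ⟨P, hP, hP₁, hP₂⟩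
  obtain ⟨R, hR, hR'⟩ := HasCardinalFilteredGenerator.exists_small_generator K μ
  refine ⟨{X | R X}, hR, fun A hA => ?_, fun X => ?_⟩
  · have : IsCardinalPresentable A μ := hR'.le_isCardinalPresentable A hA
    exact isGenerated_of_isCardinalPresentable
  · obtain ⟨J, _, _, ⟨p⟩⟩ := hR'.exists_colimitsOfShape X
    obtain ⟨α, _, _, Φ, _⟩ := IsCardinalFiltered.exists_cardinal_directed J μ
    exact ⟨{
      I := α
      directed := cardinalDirected_of_isCardinalFiltered
      D := Φ ⋙ p.diag
      mem := fun i => p.prop_diag_obj _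
      inM := fun _ _ _ => trivial
      c := p.cocone.whisker Φ
      pt_eq := rfl
      isColimit := (Functor.Final.isColimitWhiskerEquiv Φ p.cocone).symm p.isColimit }⟩

end LocallyGen
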